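/- Let 1/2 < α < 1. There exist constants C > 0 and 0 < r₀ < 1/72 such that the first component u₁ of the velocity u^α_+ = K ∗ ω^α_+ satisfies u₁(x) ≥ C (log(1/|x|))^{1−α} for every x ∈ B⁺(0;r₀). In particular, u^α_+ is unbounded. -/

import Mathlib

open MeasureTheory Real Metric Filter
open scoped ENNReal Topology

/-- The plane `ℝ²` with the Euclidean norm. -/
noncomputable abbrev E2 : Type := EuclideanSpace ℝ (Fin 2)

/-- The 2D Biot–Savart kernel `K(x) = x^⊥ / (2π|x|²)`. -/
noncomputable def K2 (x : E2) : E2 :=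
  (2 * Real.pi * ‖x‖ ^ 2)⁻¹ • (WithLp.equiv 2 (Fin 2 → ℝ)).symm ![-(x 1), x 0]

/-- The velocity field `u = K ∗ ω` obtained from a vorticity `ω` by the Biot–Savart law. -/
noncomputable def vel (ω : E2 → ℝ) (x : E2) : E2 := ∫ y, ω y • K2 (x - y)

/-- The vorticity `ω^α_+`, equal to `1/(|x| |log|x||^α)` on the upper half-disk
`B⁺(0;1/3)` and zero elsewhere. -/
noncomputable def omegaPlus (α : ℝ) (x : E2) : ℝ :=
  if ‖x‖ < 1/3 ∧ 0 < x 1 then 1 / (‖x‖ * |Real.log ‖x‖| ^ α) else 0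

lemma indicator_Ioc_mul_radius (a b : ℝ) (h : ℝ → ℝ) :
    ∀ r ∈ Set.Ioi (0 : ℝ), r ^ (Module.finrank ℝ E2 - 1) • (Set.Ioc a b).indicator h r =
      (Set.Ioc a b).indicator (fun r => r * h r) r := by
  intro r _
  by_cases hr : r ∈ Set.Ioc a b <;> simp [hr]

lemma integrable_indicator_Ioc_norm {a b : ℝ} {h : ℝ → ℝ}
    (hh : IntegrableOn (fun r => r * h r) (Set.Ioc a b)) :
    Integrable (fun y : E2 => (Set.Ioc a b).indicator h ‖y‖) := by
  rw [integrable_fun_norm_addHaar (volume : Measure E2) (f := (Set.Ioc a b).indicator h),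
    integrableOn_congr_fun (indicator_Ioc_mul_radius a b h) measurableSet_Ioi]
  exact ((integrable_indicator_iff measurableSet_Ioc).2 hh).integrableOn

lemma integral_indicator_Ioc_norm {a b : ℝ} (ha : 0 ≤ a) (hab : a ≤ b) (h : ℝ → ℝ) :
    ∫ y : E2, (Set.Ioc a b).indicator h ‖y‖ = 2 * π * ∫ r in a..b, r * h r := by
  rw [integral_fun_norm_addHaar (volume : Measure E2) ((Set.Ioc a b).indicator h),
    setIntegral_congr_fun measurableSet_Ioi (indicator_Ioc_mul_radius a b h),
    setIntegral_indicator measurableSet_Ioc, intervalIntegral.integral_of_le hab,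
    Set.inter_eq_right.2 fun r (hr : r ∈ Set.Ioc a b) => Set.mem_Ioi.2 (ha.trans_lt hr.1)]
  simp [Measure.real, EuclideanSpace.volume_ball_fin_two, pi_nonneg, mul_assoc]

lemma integrable_indicator_inv_norm (b : ℝ) :
    Integrable (fun y : E2 => (Set.Ioc 0 b).indicator (fun r => r⁻¹) ‖y‖) := by
  refine integrable_indicator_Ioc_norm ?_
  refine (integrableOn_const (C := (1 : ℝ)) (by simp)).congr_fun (fun r hr => ?_) measurableSet_Ioc
  exact (mul_inv_cancel₀ hr.1.ne').symm

lemma integral_indicator_inv_norm {b : ℝ} (hb : 0 ≤ b) :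
    ∫ y : E2, (Set.Ioc 0 b).indicator (fun r => r⁻¹) ‖y‖ = 2 * π * b := by
  rw [integral_indicator_Ioc_norm le_rfl hb, intervalIntegral.integral_of_le hb,
    setIntegral_congr_fun (g := fun _ => (1 : ℝ)) measurableSet_Ioc
      fun r hr => mul_inv_cancel₀ hr.1.ne']
  simp [hb]

lemma continuousOn_radius_mul_inv_cube {a b : ℝ} (ha : 0 < a) :
    ContinuousOn (fun r : ℝ => r * (r ^ 3)⁻¹) (Set.Icc a b) := by
  refine continuousOn_id.mul ((continuousOn_id.pow 3).inv₀ fun r hr => ?_)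
  exact pow_ne_zero _ (ha.trans_le hr.1).ne'

lemma integrable_indicator_inv_cube_norm {a : ℝ} (ha : 0 < a) (b : ℝ) :
    Integrable (fun y : E2 => (Set.Ioc a b).indicator (fun r => (r ^ 3)⁻¹) ‖y‖) :=
  integrable_indicator_Ioc_norm <|
    (continuousOn_radius_mul_inv_cube ha).integrableOn_Icc.mono_set Set.Ioc_subset_Icc_self

lemma integral_indicator_inv_cube_norm_le {a b : ℝ} (ha : 0 < a) (hab : a ≤ b) :
    ∫ y : E2, (Set.Ioc a b).indicator (fun r => (r ^ 3)⁻¹) ‖y‖ ≤ 2 * π * a⁻¹ := by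
  rw [integral_indicator_Ioc_norm ha.le hab,
    intervalIntegral.integral_eq_sub_of_hasDerivAt (f := fun r => -r⁻¹)]
  · have : 0 < b := ha.trans_le hab
    have : 0 < b⁻¹ := by positivity
    gcongr
    linarith
  · intro r hr
    rw [Set.uIcc_of_le hab] at hr
    have hr0 : r ≠ 0 := (ha.trans_le hr.1).ne'
    refine (hasDerivAt_inv hr0).neg.congr_deriv ?_
    field_simp
  · refine ContinuousOn.intervalIntegrable ?_
    rw [Set.uIcc_of_le hab]
    exact continuousOn_radius_mul_inv_cube ha

lemma continuousOn_radius_mul_log_profile {a b : ℝ} (ha : 0 < a) (hb : b < 1) (α : ℝ) :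
    ContinuousOn (fun r : ℝ => r * (r ^ 2 * (-log r) ^ α)⁻¹) (Set.Icc a b) := by
  have hlog : ∀ r ∈ Set.Icc a b, 0 < -log r := fun r hr =>
    neg_pos.2 (log_neg (ha.trans_le hr.1) (hr.2.trans_lt hb))
  have hlogc : ContinuousOn (fun r => -log r) (Set.Icc a b) :=
    (continuousOn_id.log fun r hr => (ha.trans_le hr.1).ne').neg
  refine continuousOn_id.mul (((continuousOn_id.pow 2).mul
    (hlogc.rpow_const fun r hr => Or.inl (hlog r hr).ne')).inv₀ fun r hr => ?_)
  exact mul_ne_zero (pow_ne_zero _ (ha.trans_le hr.1).ne') (rpow_pos_of_pos (hlog r hr) _).ne'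

lemma integrable_indicator_log_profile_norm {a b : ℝ} (ha : 0 < a) (hb : b < 1) (α : ℝ) :
    Integrable (fun y : E2 =>
      (Set.Ioc a b).indicator (fun r => (r ^ 2 * (-log r) ^ α)⁻¹) ‖y‖) :=
  integrable_indicator_Ioc_norm <|
    (continuousOn_radius_mul_log_profile ha hb α).integrableOn_Icc.mono_set
      Set.Ioc_subset_Icc_self

lemma integral_indicator_log_profile_norm {a b α : ℝ} (ha : 0 < a) (hab : a ≤ b) (hb : b < 1)
    (hα : α < 1) :
    ∫ y : E2, (Set.Ioc a b).indicator (fun r => (r ^ 2 * (-log r) ^ α)⁻¹) ‖y‖ =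
      2 * π * (((-log a) ^ (1 - α) - (-log b) ^ (1 - α)) / (1 - α)) := by
  have hα' : 1 - α ≠ 0 := by linarith
  rw [integral_indicator_Ioc_norm ha.le hab,
    intervalIntegral.integral_eq_sub_of_hasDerivAt
      (f := fun r => -((-log r) ^ (1 - α) / (1 - α)))]
  · ring
  · intro r hr
    rw [Set.uIcc_of_le hab] at hr
    have hr0 : 0 < r := ha.trans_le hr.1
    have hl : 0 < -log r := neg_pos.2 (log_neg hr0 (hr.2.trans_lt hb))
    refine ((((hasDerivAt_log hr0.ne').neg).rpow_const (p := 1 - α)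
      (Or.inl hl.ne')).div_const (1 - α)).neg.congr_deriv ?_
    rw [show 1 - α - 1 = -α by ring, Pi.neg_apply, rpow_neg hl.le]
    field_simp
  · refine ContinuousOn.intervalIntegrable ?_
    rw [Set.uIcc_of_le hab]
    exact continuousOn_radius_mul_log_profile ha hb α

lemma abs_apply_le_norm (y : E2) (i : Fin 2) : |y i| ≤ ‖y‖ := by
  simpa using PiLp.norm_apply_le y i

lemma norm_le_abs_add_abs (y : E2) : ‖y‖ ≤ |y 0| + |y 1| := by
  rw [EuclideanSpace.norm_eq]
  refine sqrt_le_iff.2 ⟨by positivity, ?_⟩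
  simp only [Fin.sum_univ_two, norm_eq_abs]
  nlinarith [abs_nonneg (y 0), abs_nonneg (y 1)]

lemma integral_comp_linearIsometryEquiv (e : E2 ≃ₗᵢ[ℝ] E2) (F : E2 → ℝ) :
    ∫ y, F (e y) = ∫ y, F y :=
  e.measurePreserving.integral_comp e.toHomeomorph.measurableEmbedding F

lemma integrable_radial_mul_posPart {φ : ℝ → ℝ} (hφm : Measurable φ)
    (hint : Integrable fun y : E2 => φ ‖y‖ * ‖y‖) (s : ℝ) (hs : |s| = 1) (i : Fin 2) :
    Integrable fun y : E2 => φ ‖y‖ * max (s * y i) 0 := by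
  refine hint.mono (by fun_prop) (Eventually.of_forall fun y => ?_)
  rw [norm_mul, norm_mul, norm_norm]
  gcongr
  rw [norm_of_nonneg (le_max_right _ _)]
  refine max_le ((le_abs_self _).trans ?_) (norm_nonneg _)
  rw [abs_mul, hs, one_mul]
  exact abs_apply_le_norm y i

/-- By the symmetries of the plane, the positive part of one coordinate carries at least a quarter
of the mass of a radial weight. -/
lemma quarter_integral_radial_le {φ : ℝ → ℝ} (hφm : Measurable φ) (hφ : ∀ r, 0 ≤ φ r)
    (hint : Integrable fun y : E2 => φ ‖y‖ * ‖y‖) :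
    (1 / 4) * ∫ y : E2, φ ‖y‖ * ‖y‖ ≤ ∫ y : E2, φ ‖y‖ * max (y 1) 0 := by
  have hi := integrable_radial_mul_posPart hφm hint
  have hneg : ∀ i, ∫ y : E2, φ ‖y‖ * max (-1 * y i) 0 = ∫ y : E2, φ ‖y‖ * max (1 * y i) 0 :=
    fun i => by
      rw [← integral_comp_linearIsometryEquiv (LinearIsometryEquiv.neg ℝ)]
      simp
  have hswap : ∫ y : E2, φ ‖y‖ * max (1 * y 0) 0 = ∫ y : E2, φ ‖y‖ * max (1 * y 1) 0 := by
    rw [← integral_comp_linearIsometryEquiv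
      (LinearIsometryEquiv.piLpCongrLeft 2 ℝ ℝ (Equiv.swap 0 1))]
    simp only [LinearIsometryEquiv.norm_map]
    rfl
  have hi1 := hi 1 (by simp)
  have hi2 := hi (-1) (by simp)
  have hle : ∫ y : E2, φ ‖y‖ * ‖y‖ ≤
      ∫ y : E2, (φ ‖y‖ * max (1 * y 0) 0 + φ ‖y‖ * max (-1 * y 0) 0) +
        (φ ‖y‖ * max (1 * y 1) 0 + φ ‖y‖ * max (-1 * y 1) 0) := by
    refine integral_mono hint (((hi1 0).add (hi2 0)).add ((hi1 1).add (hi2 1))) fun y => ?_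
    have h (t : ℝ) : max (1 * t) 0 + max (-1 * t) 0 = |t| := by
      rcases le_total 0 t with ht | ht <;> simp [ht, abs_of_nonneg, abs_of_nonpos]
    simp only [← mul_add, h]
    exact mul_le_mul_of_nonneg_left (norm_le_abs_add_abs y) (hφ _)
  rw [integral_add (by exact (hi1 0).add (hi2 0)) (by exact (hi1 1).add (hi2 1)),
    integral_add (hi1 0) (hi2 0), integral_add (hi1 1) (hi2 1), hneg, hneg, hswap] at hle
  simp only [one_mul] at hle
  linarith

lemma norm_perp (z : E2) : ‖(WithLp.equiv 2 (Fin 2 → ℝ)).symm ![-(z 1), z 0]‖ = ‖z‖ := by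
  simp [EuclideanSpace.norm_eq, add_comm]

lemma norm_K2_le (z : E2) : ‖K2 z‖ ≤ ‖z‖⁻¹ := by
  rw [K2, norm_smul, norm_perp, norm_of_nonneg (by positivity)]
  rcases (norm_nonneg z).eq_or_lt with hz | hz
  · simp [← hz]
  · have h : (2 * π * ‖z‖ ^ 2)⁻¹ * ‖z‖ = (2 * π)⁻¹ * ‖z‖⁻¹ := by field_simp
    rw [h]
    refine mul_le_of_le_one_left (by positivity) (inv_le_one_of_one_le₀ ?_)
    linarith [pi_gt_three]

lemma measurable_K2 : Measurable K2 := by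
  have hperp : Measurable fun x : E2 => (WithLp.equiv 2 (Fin 2 → ℝ)).symm ![-(x 1), x 0] := by
    refine (WithLp.measurable_toLp 2 (Fin 2 → ℝ)).comp (measurable_pi_lambda _ fun i => ?_)
    fin_cases i
    · exact (by fun_prop : Measurable fun x : E2 => -(x 1))
    · exact (by fun_prop : Measurable fun x : E2 => x 0)
  exact (by fun_prop : Measurable fun x : E2 => (2 * π * ‖x‖ ^ 2)⁻¹).smul hperp

lemma omegaPlus_smul_K2_apply_zero (α : ℝ) (x y : E2) :
    (omegaPlus α y • K2 (x - y)) 0 =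
      (2 * π)⁻¹ * (omegaPlus α y * ((y 1 - x 1) / ‖x - y‖ ^ 2)) := by
  simp [K2]
  ring

lemma measurable_omegaPlus (α : ℝ) : Measurable (omegaPlus α) := by
  unfold omegaPlus
  refine Measurable.ite ?_ (by fun_prop) measurable_const
  exact (measurableSet_lt measurable_norm measurable_const).inter
    (measurableSet_lt measurable_const (by fun_prop : Measurable fun x : E2 => x 1))

lemma omegaPlus_nonneg (α : ℝ) (y : E2) : 0 ≤ omegaPlus α y := by
  unfold omegaPlus
  split_ifs <;> positivity

lemma norm_pos_of_apply_pos {y : E2} {i : Fin 2} (hy : 0 < y i) : 0 < ‖y‖ :=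
  hy.trans_le ((le_abs_self _).trans (abs_apply_le_norm y i))

lemma one_lt_abs_log {r : ℝ} (hr : 0 < r) (hr' : r < 1 / 3) : 1 < |log r| := by
  rw [lt_abs, ← log_inv]
  right
  rw [lt_log_iff_exp_lt (by positivity)]
  have : (3 : ℝ) < r⁻¹ := (lt_inv_comm₀ (by norm_num) hr).2 (by linarith)
  linarith [exp_one_lt_d9]

lemma omegaPlus_le_indicator {α : ℝ} (hα : 0 ≤ α) (y : E2) :
    omegaPlus α y ≤ (Set.Ioc 0 (1 / 3)).indicator (fun r => r⁻¹) ‖y‖ := by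
  unfold omegaPlus
  split_ifs with h
  · have hy := norm_pos_of_apply_pos h.2
    rw [Set.indicator_of_mem (show ‖y‖ ∈ Set.Ioc 0 (1 / 3) from ⟨hy, h.1.le⟩), one_div]
    gcongr
    exact le_mul_of_one_le_right hy.le (one_le_rpow (one_lt_abs_log hy h.1).le hα)
  · exact Set.indicator_nonneg (fun r hr => inv_nonneg.2 hr.1.le) _

lemma inv_mul_inv_le_of_le_add {a b ρ : ℝ} (ha : 0 ≤ a) (hb : 0 ≤ b) (hρ : 0 < ρ)
    (h : ρ ≤ a + b) : a⁻¹ * b⁻¹ ≤ ρ⁻¹ * (a⁻¹ + b⁻¹) := by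
  rcases ha.eq_or_lt with rfl | ha'
  · simp; positivity
  rcases hb.eq_or_lt with rfl | hb'
  · simp; positivity
  rw [inv_add_inv ha'.ne' hb'.ne', ← mul_inv, ← div_eq_inv_mul, div_div, ← one_div,
    div_le_div_iff₀ (by positivity) (by positivity)]
  nlinarith [mul_pos ha' hb']

lemma integrable_indicator_inv_norm_sub (x : E2) (b : ℝ) :
    Integrable (fun y : E2 => (Set.Ioc 0 b).indicator (fun r => r⁻¹) ‖x - y‖) :=
  (integrable_indicator_inv_norm b).comp_sub_left x

lemma integrable_omegaPlus_smul_K2 {α : ℝ} (hα : 0 ≤ α) {x : E2} (hx : 0 < ‖x‖) :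
    Integrable fun y => omegaPlus α y • K2 (x - y) := by
  refine Integrable.mono' (((integrable_indicator_inv_norm (1 / 3)).add
    (integrable_indicator_inv_norm_sub x (‖x‖ + 1 / 3))).const_mul ‖x‖⁻¹)
    ((measurable_omegaPlus α).smul
      (measurable_K2.comp (by fun_prop))).aestronglyMeasurable (Eventually.of_forall fun y => ?_)
  rw [norm_smul, norm_of_nonneg (omegaPlus_nonneg α y)]
  refine (mul_le_mul (omegaPlus_le_indicator hα y) (norm_K2_le _) (norm_nonneg _)
    (Set.indicator_nonneg (fun r hr => inv_nonneg.2 hr.1.le) _)).trans ?_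
  have hnn (s : ℝ) : 0 ≤ (Set.Ioc 0 (‖x‖ + 1 / 3)).indicator (fun r => r⁻¹) s :=
    Set.indicator_nonneg (fun r hr => inv_nonneg.2 hr.1.le) _
  simp only [Pi.add_apply]
  by_cases hy : ‖y‖ ∈ Set.Ioc 0 (1 / 3)
  · rw [Set.indicator_of_mem hy]
    refine (inv_mul_inv_le_of_le_add (norm_nonneg y) (norm_nonneg _) hx
      (norm_le_norm_add_norm_sub' x y)).trans ?_
    gcongr
    rcases (norm_nonneg (x - y)).eq_or_lt with h | h
    · simp [← h]
    · rw [Set.indicator_of_mem (show ‖x - y‖ ∈ Set.Ioc 0 (‖x‖ + 1 / 3) from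
        ⟨h, (norm_sub_le x y).trans (by gcongr; exact hy.2)⟩)]
  · rw [Set.indicator_of_notMem hy, zero_mul, zero_add]
    exact mul_nonneg (by positivity) (hnn _)

lemma integrable_omegaPlus_mul_apply_zero {α : ℝ} (hα : 0 ≤ α) {x : E2} (hx : 0 < ‖x‖) :
    Integrable fun y => omegaPlus α y * ((y 1 - x 1) / ‖x - y‖ ^ 2) := by
  have h := ((integrable_omegaPlus_smul_K2 hα hx).eval_piLp 0).const_mul (2 * π)
  refine h.congr (Eventually.of_forall fun y => ?_)
  simp only [omegaPlus_smul_K2_apply_zero]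
  field_simp

lemma vel_omegaPlus_apply_zero {α : ℝ} (hα : 0 ≤ α) {x : E2} (hx : 0 < ‖x‖) :
    vel (omegaPlus α) x 0 =
      (2 * π)⁻¹ * ∫ y, omegaPlus α y * ((y 1 - x 1) / ‖x - y‖ ^ 2) := by
  rw [vel, ← integral_const_mul]
  simp only [← omegaPlus_smul_K2_apply_zero]
  exact ((EuclideanSpace.proj (𝕜 := ℝ) (0 : Fin 2)).integral_comp_comm
    (integrable_omegaPlus_smul_K2 hα hx)).symm

/-- The radial weight which, multiplied by `y₁⁺`, bounds the main part of the velocity integrand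
from below. -/
noncomputable def logWeight (α a : ℝ) : ℝ → ℝ :=
  (Set.Ioc a (1 / 4)).indicator fun r => (r ^ 3 * (-log r) ^ α)⁻¹

lemma measurable_logWeight (α a : ℝ) : Measurable (logWeight α a) :=
  Measurable.indicator (by fun_prop) measurableSet_Ioc

lemma logWeight_nonneg (α : ℝ) {a : ℝ} (ha : 0 ≤ a) (r : ℝ) : 0 ≤ logWeight α a r := by
  refine Set.indicator_nonneg (fun r hr => ?_) r
  have hr0 : 0 < r := ha.trans_lt hr.1
  have : 0 < -log r := neg_pos.2 (log_neg hr0 (hr.2.trans_lt (by norm_num)))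
  positivity

lemma logWeight_mul_self {α a : ℝ} (ha : 0 ≤ a) (r : ℝ) :
    logWeight α a r * r = (Set.Ioc a (1 / 4)).indicator (fun r => (r ^ 2 * (-log r) ^ α)⁻¹) r := by
  by_cases hr : r ∈ Set.Ioc a (1 / 4)
  · have hr0 : 0 < r := ha.trans_lt hr.1
    rw [logWeight, Set.indicator_of_mem hr, Set.indicator_of_mem hr]
    field_simp
  · rw [logWeight, Set.indicator_of_notMem hr, Set.indicator_of_notMem hr, zero_mul]

lemma logWeight_mul_sq_le_omegaPlus (α a : ℝ) {y : E2} (hy : 0 < y 1) :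
    logWeight α a ‖y‖ * ‖y‖ ^ 2 ≤ omegaPlus α y := by
  by_cases hr : ‖y‖ ∈ Set.Ioc a (1 / 4)
  · have hr0 : 0 < ‖y‖ := norm_pos_of_apply_pos hy
    have h3 : ‖y‖ < 1 / 3 := hr.2.trans_lt (by norm_num)
    rw [logWeight, Set.indicator_of_mem hr, omegaPlus, if_pos ⟨h3, hy⟩,
      abs_of_neg (log_neg hr0 (by linarith))]
    apply le_of_eq
    field_simp
  · rw [logWeight, Set.indicator_of_notMem hr, zero_mul]
    exact omegaPlus_nonneg α y

lemma lower_bound_integrand {α : ℝ} (hα : 0 ≤ α) {x : E2} (hx1 : 0 < x 1) (y : E2) :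
    4 / 9 * (logWeight α (2 * ‖x‖) ‖y‖ * max (y 1) 0)
      - 4 * ‖x‖ * (Set.Ioc (2 * ‖x‖) (1 / 3)).indicator (fun r => (r ^ 3)⁻¹) ‖y‖
      - ‖x‖⁻¹ * ((Set.Ioc 0 (2 * ‖x‖)).indicator (fun r => r⁻¹) ‖y‖
        + (Set.Ioc 0 (3 * ‖x‖)).indicator (fun r => r⁻¹) ‖x - y‖) ≤
      omegaPlus α y * ((y 1 - x 1) / ‖x - y‖ ^ 2) := by
  have hx : 0 < ‖x‖ := norm_pos_of_apply_pos hx1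
  have hcube : 0 ≤ 4 * ‖x‖ *
      (Set.Ioc (2 * ‖x‖) (1 / 3)).indicator (fun r => (r ^ 3)⁻¹) ‖y‖ :=
    mul_nonneg (by positivity) (Set.indicator_nonneg
      (fun r hr => inv_nonneg.2 (pow_nonneg (by linarith [hr.1]) 3)) _)
  have hinv (b s : ℝ) : 0 ≤ (Set.Ioc 0 b).indicator (fun r => r⁻¹) s :=
    Set.indicator_nonneg (fun r hr => inv_nonneg.2 hr.1.le) _
  have hnear : 0 ≤ ‖x‖⁻¹ * ((Set.Ioc 0 (2 * ‖x‖)).indicator (fun r => r⁻¹) ‖y‖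
      + (Set.Ioc 0 (3 * ‖x‖)).indicator (fun r => r⁻¹) ‖x - y‖) :=
    mul_nonneg (by positivity) (add_nonneg (hinv _ _) (hinv _ _))
  by_cases hy : ‖y‖ < 1 / 3 ∧ 0 < y 1
  swap
  · have hmain : logWeight α (2 * ‖x‖) ‖y‖ * max (y 1) 0 = 0 := by
      rcases not_and_or.1 hy with h | h
      · rw [logWeight, Set.indicator_of_notMem (fun h' => h (h'.2.trans_lt (by norm_num))),
          zero_mul]
      · rw [max_eq_right (not_lt.1 h), mul_zero]
    rw [omegaPlus, if_neg hy, hmain]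
    linarith
  obtain ⟨hy3, hy1⟩ := hy
  have hy0 : 0 < ‖y‖ := norm_pos_of_apply_pos hy1
  have hω0 := omegaPlus_nonneg α y
  have hω : omegaPlus α y ≤ ‖y‖⁻¹ := by
    have := omegaPlus_le_indicator hα y
    rwa [Set.indicator_of_mem (show ‖y‖ ∈ Set.Ioc 0 (1 / 3) from ⟨hy0, hy3.le⟩)] at this
  rcases le_or_gt ‖y‖ (2 * ‖x‖) with hyx | hyx
  · have hmain : logWeight α (2 * ‖x‖) ‖y‖ = 0 :=
      Set.indicator_of_notMem (fun h' => h'.1.not_ge hyx) _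
    have hkernel : -‖x - y‖⁻¹ ≤ (y 1 - x 1) / ‖x - y‖ ^ 2 := by
      rcases (norm_nonneg (x - y)).eq_or_lt with h | h
      · simp [← h]
      · have h1 : x 1 - y 1 ≤ ‖x - y‖ := (le_abs_self _).trans (abs_apply_le_norm (x - y) 1)
        rw [le_div_iff₀ (by positivity)]
        have h2 : -‖x - y‖⁻¹ * ‖x - y‖ ^ 2 = -‖x - y‖ := by field_simp
        linarith
    have hind : (Set.Ioc 0 (3 * ‖x‖)).indicator (fun r => r⁻¹) ‖x - y‖ = ‖x - y‖⁻¹ := by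
      rcases (norm_nonneg (x - y)).eq_or_lt with h | h
      · simp [← h]
      · exact Set.indicator_of_mem (s := Set.Ioc 0 (3 * ‖x‖))
          ⟨h, (norm_sub_le x y).trans (by linarith)⟩ _
    have hprod := inv_mul_inv_le_of_le_add (norm_nonneg y) (norm_nonneg _) hx
      (norm_le_norm_add_norm_sub' x y)
    rw [hmain, hind, Set.indicator_of_mem (show ‖y‖ ∈ Set.Ioc 0 (2 * ‖x‖) from ⟨hy0, hyx⟩)]
    have h1 := mul_le_mul_of_nonneg_left hkernel hω0
    have h2 := mul_le_mul_of_nonneg_right hω (inv_nonneg.2 (norm_nonneg (x - y)))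
    linarith
  · have hs1 : ‖x - y‖ ≤ 3 / 2 * ‖y‖ := (norm_sub_le x y).trans (by linarith)
    have hs2 : ‖y‖ / 2 ≤ ‖x - y‖ := by
      have := norm_le_norm_add_norm_sub' y x
      rw [norm_sub_rev y x] at this
      linarith
    have hs : 0 < ‖x - y‖ := by linarith
    have hmain : 4 / 9 * (logWeight α (2 * ‖x‖) ‖y‖ * max (y 1) 0) ≤
        omegaPlus α y * (y 1 / ‖x - y‖ ^ 2) := by
      rw [max_eq_left hy1.le]
      calc 4 / 9 * (logWeight α (2 * ‖x‖) ‖y‖ * y 1)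
          = (logWeight α (2 * ‖x‖) ‖y‖ * ‖y‖ ^ 2) * (y 1 / (3 / 2 * ‖y‖) ^ 2) := by
            field_simp; ring
        _ ≤ _ := by
            gcongr
            exact logWeight_mul_sq_le_omegaPlus α _ hy1
    have herr : omegaPlus α y * (x 1 / ‖x - y‖ ^ 2) ≤ 4 * ‖x‖ * (‖y‖ ^ 3)⁻¹ := by
      calc omegaPlus α y * (x 1 / ‖x - y‖ ^ 2) ≤ ‖y‖⁻¹ * (‖x‖ / (‖y‖ / 2) ^ 2) := by
            gcongr
            exact (le_abs_self _).trans (abs_apply_le_norm x 1)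
        _ = _ := by field_simp; ring
    rw [Set.indicator_of_mem (show ‖y‖ ∈ Set.Ioc (2 * ‖x‖) (1 / 3) from ⟨hyx, hy3.le⟩),
      sub_div, mul_sub]
    linarith

lemma vel_omegaPlus_apply_zero_ge {α : ℝ} (hα : 0 ≤ α) (hα' : α < 1) {x : E2} (hx1 : 0 < x 1)
    (hx8 : 2 * ‖x‖ ≤ 1 / 4) :
    ((-log (2 * ‖x‖)) ^ (1 - α) - (-log (1 / 4)) ^ (1 - α)) / (1 - α) / 9 - 7 ≤
      vel (omegaPlus α) x 0 := by
  have hx : 0 < ‖x‖ := norm_pos_of_apply_pos hx1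
  have ha : 0 < 2 * ‖x‖ := by positivity
  have hprofile := integrable_indicator_log_profile_norm ha (b := 1 / 4) (by norm_num) α
  simp only [← logWeight_mul_self ha.le] at hprofile
  have hquarter := quarter_integral_radial_le (measurable_logWeight α (2 * ‖x‖))
    (logWeight_nonneg α ha.le) hprofile
  have hmainI : Integrable fun y : E2 => logWeight α (2 * ‖x‖) ‖y‖ * max (y 1) 0 := by
    simpa using integrable_radial_mul_posPart (measurable_logWeight α (2 * ‖x‖)) hprofile 1
      (by simp) 1
  have hcubeI := integrable_indicator_inv_cube_norm ha (1 / 3)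
  have hyI := integrable_indicator_inv_norm (2 * ‖x‖)
  have hxyI := integrable_indicator_inv_norm_sub x (3 * ‖x‖)
  have hmono := integral_mono
    (by
      exact ((hmainI.const_mul (4 / 9)).sub (hcubeI.const_mul (4 * ‖x‖))).sub
        ((hyI.add hxyI).const_mul ‖x‖⁻¹))
    (integrable_omegaPlus_mul_apply_zero hα hx) (lower_bound_integrand hα hx1)
  rw [integral_sub (by exact (hmainI.const_mul (4 / 9)).sub (hcubeI.const_mul (4 * ‖x‖)))
      (by exact (hyI.add hxyI).const_mul ‖x‖⁻¹),
    integral_sub (hmainI.const_mul (4 / 9)) (hcubeI.const_mul (4 * ‖x‖)),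
    integral_const_mul, integral_const_mul, integral_const_mul, integral_add hyI hxyI,
    integral_sub_left_eq_self (fun z : E2 => (Set.Ioc 0 (3 * ‖x‖)).indicator (fun r => r⁻¹) ‖z‖),
    integral_indicator_inv_norm ha.le, integral_indicator_inv_norm (by positivity)] at hmono
  have hcube := mul_le_mul_of_nonneg_left
    (integral_indicator_inv_cube_norm_le ha (b := 1 / 3) (by linarith))
    (show 0 ≤ 4 * ‖x‖ by positivity)
  simp only [logWeight_mul_self ha.le] at hquarter
  rw [integral_indicator_log_profile_norm ha hx8 (by norm_num) hα'] at hquarter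
  have h1 : 4 * ‖x‖ * (2 * π * (2 * ‖x‖)⁻¹) = 2 * π * 2 := by field_simp; ring
  have h2 : ‖x‖⁻¹ * (2 * π * (2 * ‖x‖) + 2 * π * (3 * ‖x‖)) = 2 * π * 5 := by
    field_simp; ring
  rw [vel_omegaPlus_apply_zero hα hx, ← div_eq_inv_mul, le_div_iff₀ (by positivity)]
  linarith

lemma half_mul_rpow_neg_log_le {ρ β : ℝ} (hρ : 0 < ρ) (hρ' : ρ ≤ 1 / 4) (hβ : 0 ≤ β)
    (hβ' : β ≤ 1) : 1 / 2 * (-log ρ) ^ β ≤ (-log (2 * ρ)) ^ β := by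
  have h2 : 0 < log 2 := log_pos (by norm_num)
  have h4 : log ρ ≤ -(2 * log 2) := by
    have := log_le_log hρ hρ'
    rwa [show (1 / 4 : ℝ) = (2 ^ 2)⁻¹ by norm_num, log_inv, log_pow, Nat.cast_ofNat] at this
  calc 1 / 2 * (-log ρ) ^ β ≤ (1 / 2) ^ β * (-log ρ) ^ β := by
        gcongr
        · exact rpow_nonneg (by linarith) _
        · simpa using rpow_le_rpow_of_exponent_ge (x := 1 / 2) (by norm_num) (by norm_num) hβ'
    _ = (1 / 2 * -log ρ) ^ β := (mul_rpow (by norm_num) (by linarith)).symm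
    _ ≤ _ := by
        refine rpow_le_rpow (by linarith) ?_ hβ
        rw [log_mul (by norm_num) hρ.ne']
        linarith

lemma tendsto_neg_log_rpow_nhdsGT_zero {β : ℝ} (hβ : 0 < β) :
    Tendsto (fun ρ : ℝ => (-log ρ) ^ β) (𝓝[>] 0) atTop :=
  (tendsto_rpow_atTop hβ).comp (tendsto_neg_atBot_atTop.comp tendsto_log_nhdsGT_zero)

theorem u1_log_lower_bound (α : ℝ) (hα1 : 1/2 < α) (hα2 : α < 1) :
    ∃ C : ℝ, 0 < C ∧ ∃ r0 : ℝ, 0 < r0 ∧ r0 < 1/72 ∧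
      (∀ x : E2, ‖x‖ < r0 → 0 < x 1 →
        C * Real.log (1/‖x‖) ^ (1 - α) ≤ vel (omegaPlus α) x 0) ∧
      ∀ M : ℝ, ∃ x : E2, M < ‖vel (omegaPlus α) x‖ := by
  have hβ : 0 < 1 - α := by linarith
  have hlim := tendsto_neg_log_rpow_nhdsGT_zero hβ
  set c : ℝ := 1 / (36 * (1 - α)) with hc
  have hc0 : 0 < c := by positivity
  set D : ℝ := 7 + (-log (1 / 4)) ^ (1 - α) / (1 - α) / 9 with hD
  obtain ⟨ε, hε, hεsub⟩ :=
    mem_nhdsGT_iff_exists_Ioo_subset.1 (hlim.eventually_ge_atTop (D / c))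
  have hr0 : 0 < min ε (1 / 100) := lt_min hε (by norm_num)
  have hbound : ∀ x : E2, ‖x‖ < min ε (1 / 100) → 0 < x 1 →
      c * Real.log (1/‖x‖) ^ (1 - α) ≤ vel (omegaPlus α) x 0 := by
    intro x hxr hx1
    have hx : 0 < ‖x‖ := norm_pos_of_apply_pos hx1
    have hx100 : ‖x‖ < 1 / 100 := hxr.trans_le (min_le_right _ _)
    have hlarge : D / c ≤ (-log ‖x‖) ^ (1 - α) := hεsub ⟨hx, hxr.trans_le (min_le_left _ _)⟩
    rw [div_le_iff₀' hc0] at hlarge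
    have hvel := vel_omegaPlus_apply_zero_ge (by linarith) hα2 hx1 (by linarith)
    have hhalf := half_mul_rpow_neg_log_le hx (by linarith) hβ.le (by linarith)
    have hscaled : 2 * c * (-log ‖x‖) ^ (1 - α) ≤
        (-log (2 * ‖x‖)) ^ (1 - α) / (1 - α) / 9 :=
      calc 2 * c * (-log ‖x‖) ^ (1 - α) = 1 / 2 * (-log ‖x‖) ^ (1 - α) / (1 - α) / 9 := by
            rw [hc]; field_simp; ring
        _ ≤ _ := by gcongr
    rw [one_div, log_inv]
    rw [sub_div, sub_div] at hvel
    linarith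
  refine ⟨c, hc0, min ε (1 / 100), hr0, (min_le_right _ _).trans_lt (by norm_num), hbound,
    fun M => ?_⟩
  obtain ⟨ρ, hρM, hρ0, hρr⟩ := ((hlim.eventually_gt_atTop (M / c)).and
    (Ioo_mem_nhdsGT hr0)).exists
  refine ⟨EuclideanSpace.single 1 ρ, ?_⟩
  have hnorm : ‖(EuclideanSpace.single 1 ρ : E2)‖ = ρ := by simp [abs_of_pos hρ0]
  have h := hbound (EuclideanSpace.single 1 ρ) (by rwa [hnorm]) (by simpa using hρ0)
  rw [hnorm, one_div, log_inv] at h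
  rw [div_lt_iff₀' hc0] at hρM
  exact (hρM.trans_le h).trans_le ((le_abs_self _).trans (abs_apply_le_norm _ 0))
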